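/- Measurable selection of one-step martingale measures (Lemma 4.8): Fix t ∈ {0,…,T−1}, let P(·) : Ω_t → 𝔓(Ω₁) be Borel, and define 𝒬_t(ω) := {Q ∈ 𝔓(Ω₁) : Q ⋘ 𝒫_t(ω), E_Q[ΔS_{t+1}(ω,·)] = 0}. Then the graph of 𝒬_t is an analytic subset of Ω_t × 𝔓(Ω₁), and there exist universally measurable maps Q(·), P̂(·) : Ω_t → 𝔓(Ω₁) such that: P(ω) ≪ Q(ω) ≪ P̂(ω) for all ω ∈ Ω_t; P̂(ω) ∈ 𝒫_t(ω) whenever P(ω) ∈ 𝒫_t(ω); and Q(ω) ∈ 𝒬_t(ω) whenever NA(𝒫_t(ω)) holds and P(ω) ∈ 𝒫_t(ω). -/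

import Mathlib

open MeasureTheory Set Filter Topology
open scoped ENNReal NNReal

noncomputable section

namespace BN

/-- The universal completion of the ambient measurable structure on `α`:
a set is measurable iff it is null-measurable for every probability measure. -/
def univComp (α : Type*) [MeasurableSpace α] : MeasurableSpace α where
  MeasurableSet' s := ∀ μ : Measure α, IsProbabilityMeasure μ → NullMeasurableSet s μ
  measurableSet_empty := fun _ _ => MeasurableSet.empty.nullMeasurableSet
  measurableSet_compl := fun _ hs μ hμ => (hs μ hμ).compl
  measurableSet_iUnion := fun _ hf μ hμ => NullMeasurableSet.iUnion fun i => hf i μ hμ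

/-- `N` is `PP`-polar: it is contained in an `m`-measurable set which is null under
every `P ∈ PP`. -/
def IsPolar {α : Type*} [MeasurableSpace α] (PP : Set (Measure α)) (m : MeasurableSpace α)
    (N : Set α) : Prop :=
  ∃ A : Set α, MeasurableSet[m] A ∧ N ⊆ A ∧ ∀ P ∈ PP, P A = 0

/-- A property holds `PP`-quasi surely if its complement is `PP`-polar. -/
def QuasiSure {α : Type*} [mα : MeasurableSpace α] (PP : Set (Measure α))
    (m : MeasurableSpace α) (p : α → Prop) : Prop :=
  @IsPolar α mα PP m {ω | ¬ p ω}

/-- Expectation of a real random variable, with the convention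
`E[f] = E[f⁺] - E[f⁻]` and `∞ - ∞ = -∞` (which holds in `EReal`). -/
def expec {α : Type*} [MeasurableSpace α] (Q : Measure α) (f : α → ℝ) : EReal :=
  ((∫⁻ x, ENNReal.ofReal (f x) ∂Q : ℝ≥0∞) : EReal)
    - ((∫⁻ x, ENNReal.ofReal (-f x) ∂Q : ℝ≥0∞) : EReal)

/-- Positive part of an extended real, valued in `ℝ≥0∞`. -/
def posE (x : EReal) : ℝ≥0∞ := if x = ⊤ then ⊤ else ENNReal.ofReal x.toReal

/-- Expectation of an extended-real random variable, with the convention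
`E[f] = E[f⁺] - E[f⁻]` and `∞ - ∞ = -∞`. -/
def eexpec {α : Type*} [MeasurableSpace α] (Q : Measure α) (f : α → EReal) : EReal :=
  ((∫⁻ x, posE (f x) ∂Q : ℝ≥0∞) : EReal) - ((∫⁻ x, posE (-(f x)) ∂Q : ℝ≥0∞) : EReal)

/-- A real-valued function is upper semianalytic if all its strict superlevel sets
are analytic. -/
def UpperSemianalytic {α : Type*} [TopologicalSpace α] (f : α → ℝ) : Prop :=
  ∀ c : ℝ, AnalyticSet {x | c < f x}

/-- An extended-real-valued function is upper semianalytic if all its strict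
superlevel sets `{f > c}`, `c ∈ ℝ`, are analytic. -/
def UpperSemianalyticE {α : Type*} [TopologicalSpace α] (f : α → EReal) : Prop :=
  ∀ c : ℝ, AnalyticSet {x | (c : EReal) < f x}

/-- Convexity of a set of probability measures. -/
def ConvexPM {α : Type*} [MeasurableSpace α] (C : Set (ProbabilityMeasure α)) : Prop :=
  ∀ μ ∈ C, ∀ ν ∈ C, ∀ a b : ℝ≥0∞, a + b = 1 →
    ∀ ξ : ProbabilityMeasure α, (ξ : Measure α) = a • (μ : Measure α) + b • (ν : Measure α) →
      ξ ∈ C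

/-! ### The general (non-Polish) setting of Section 2 -/

section General

variable {Ω : Type*} [MeasurableSpace Ω]

/-- Predictability of a trading strategy `H` with respect to a filtration `F`:
the holding `H (u+1)` over the period `(u, u+1]` is `F u`-measurable. -/
def PredictableF (F : ℕ → MeasurableSpace Ω) (T d : ℕ) (H : ℕ → Ω → Fin d → ℝ) : Prop :=
  ∀ u : ℕ, u < T → Measurable[F u] (H (u + 1))

/-- The final gain `(H · S)_T` from trading `H` in the stocks `S`. -/
def gainF {d : ℕ} (S : ℕ → Ω → Fin d → ℝ) (H : ℕ → Ω → Fin d → ℝ) (T : ℕ) (ω : Ω) : ℝ :=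
  ∑ u : Fin T, ∑ i : Fin d, H (u + 1) ω i * (S (u + 1) ω i - S u ω i)

/-- The no-arbitrage condition `NA(PP)` (no options). -/
def NAF (F : ℕ → MeasurableSpace Ω) (T d : ℕ) (S : ℕ → Ω → Fin d → ℝ)
    (PP : Set (Measure Ω)) : Prop :=
  ∀ H : ℕ → Ω → Fin d → ℝ, PredictableF F T d H →
    QuasiSure PP ‹MeasurableSpace Ω› (fun ω => 0 ≤ gainF S H T ω) →
      QuasiSure PP ‹MeasurableSpace Ω› (fun ω => gainF S H T ω = 0)

/-- The cone `𝒞` of claims superreplicable from zero initial capital. -/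
def Cset (F : ℕ → MeasurableSpace Ω) (T d : ℕ) (S : ℕ → Ω → Fin d → ℝ) : Set (Ω → ℝ) :=
  {W | ∃ H : ℕ → Ω → Fin d → ℝ, PredictableF F T d H ∧
    ∃ K : Ω → ℝ, Measurable K ∧ (∀ ω, 0 ≤ K ω) ∧ ∀ ω, W ω = gainF S H T ω - K ω}

/-- The superhedging price (no options), with values in `EReal` (`inf ∅ = +∞`). -/
def superPriceF (F : ℕ → MeasurableSpace Ω) (T d : ℕ) (S : ℕ → Ω → Fin d → ℝ)
    (PP : Set (Measure Ω)) (f : Ω → ℝ) : EReal :=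
  sInf ((fun x : ℝ => (x : EReal)) ''
    {x : ℝ | ∃ H : ℕ → Ω → Fin d → ℝ, PredictableF F T d H ∧
      QuasiSure PP ‹MeasurableSpace Ω› (fun ω => f ω ≤ x + gainF S H T ω)})

end General

/-! ### The one-period setting of Section 3 -/

section OnePeriod

variable {Ω : Type*} [MeasurableSpace Ω] {d : ℕ}

/-- One-period no-arbitrage condition `NA(PP)` for the increment `ΔS`. -/
def NA1 (PP : Set (Measure Ω)) (ΔS : Ω → Fin d → ℝ) : Prop :=
  ∀ y : Fin d → ℝ,
    QuasiSure PP ‹MeasurableSpace Ω› (fun ω => 0 ≤ ∑ i, y i * ΔS ω i) →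
      QuasiSure PP ‹MeasurableSpace Ω› (fun ω => ∑ i, y i * ΔS ω i = 0)

/-- The martingale measures dominated by `PP` in the one-period market:
`𝒬 = {Q : Q ⋘ 𝒫, E_Q[ΔS] = 0}`. -/
def Q1set (PP : Set (Measure Ω)) (ΔS : Ω → Fin d → ℝ) : Set (Measure Ω) :=
  {Q | IsProbabilityMeasure Q ∧ (∃ P ∈ PP, Q ≪ P) ∧
    ∀ i, expec Q (fun ω => ΔS ω i) = 0}

/-- One-period superhedging price, with values in `EReal` (`inf ∅ = +∞`). -/
def superPrice1 (PP : Set (Measure Ω)) (ΔS : Ω → Fin d → ℝ) (f : Ω → ℝ) : EReal :=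
  sInf ((fun x : ℝ => (x : EReal)) ''
    {x : ℝ | ∃ H : Fin d → ℝ,
      QuasiSure PP ‹MeasurableSpace Ω› (fun ω => f ω ≤ x + ∑ i, H i * ΔS ω i)})

end OnePeriod

/-! ### The Polish multi-period setting -/

section Polish

variable (Ω₁ : Type) [MeasurableSpace Ω₁]

/-- Restriction of a path up to time `t`. -/
def restr {T : ℕ} (t : ℕ) (h : t ≤ T) (ω : Fin T → Ω₁) : Fin t → Ω₁ :=
  fun i => ω (Fin.castLE h i)

/-- Universally measurable predictability: `H u` (the holding over `(u, u+1]`)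
is a universally measurable function of the first `u` coordinates. -/
def Pred (d : ℕ) (H : (u : ℕ) → (Fin u → Ω₁) → Fin d → ℝ) : Prop :=
  ∀ u : ℕ, @Measurable _ _ (univComp (Fin u → Ω₁)) _ (H u)

/-- The gain `(H · S)_t = ∑_{u=1}^t H_u (S_u - S_{u-1})` up to time `t ≤ T`. -/
def gain {T d : ℕ} (S : (t : ℕ) → (Fin t → Ω₁) → Fin d → ℝ)
    (H : (u : ℕ) → (Fin u → Ω₁) → Fin d → ℝ) (t : ℕ) (h : t ≤ T) (ω : Fin T → Ω₁) : ℝ :=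
  ∑ u : Fin t, ∑ i : Fin d,
    H u (restr Ω₁ u (u.2.le.trans h) ω) i *
      (S (u + 1) (restr Ω₁ (u + 1) (Nat.succ_le_of_lt (u.2.trans_le h)) ω) i
        - S u (restr Ω₁ u (u.2.le.trans h) ω) i)

variable [TopologicalSpace Ω₁] [OpensMeasurableSpace Ω₁]

/-- The set `PP = {P₀ ⊗ ⋯ ⊗ P_{t-1}}` of measures built from universally
measurable selectors of the one-step collections `𝒫_s(·)`. -/
def MeasFam (Pt : (t : ℕ) → (Fin t → Ω₁) → Set (ProbabilityMeasure Ω₁)) :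
    (t : ℕ) → Set (Measure (Fin t → Ω₁))
  | 0 => {μ | μ = Measure.dirac Fin.elim0}
  | (t + 1) => {μ | ∃ ν ∈ MeasFam Pt t, ∃ κ : (Fin t → Ω₁) → ProbabilityMeasure Ω₁,
      @Measurable _ _ (univComp (Fin t → Ω₁)) (borel (ProbabilityMeasure Ω₁)) κ ∧
      (∀ ω, κ ω ∈ Pt t ω) ∧
      μ = ν.bind (fun ω => Measure.map (Fin.snoc ω) (κ ω : Measure Ω₁))}

/-- The σ-field `ℱ_t` on `Ω = Ω₁^T`: the comap under the restriction map of the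
universal completion of the Borel σ-field of `Ω₁^t`. -/
def filtr (T : ℕ) (t : ℕ) (h : t ≤ T) : MeasurableSpace (Fin T → Ω₁) :=
  MeasurableSpace.comap (restr Ω₁ t h) (univComp (Fin t → Ω₁))

/-- `S` is a `Q`-martingale with respect to the filtration `(ℱ_t)`. -/
def IsMartMeas {T d : ℕ} (S : (t : ℕ) → (Fin t → Ω₁) → Fin d → ℝ)
    (Q : Measure (Fin T → Ω₁)) : Prop :=
  (∀ (t : ℕ) (h : t ≤ T) (i : Fin d), Integrable (fun ω => S t (restr Ω₁ t h ω) i) Q) ∧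
  (∀ (t : ℕ) (h : t + 1 ≤ T) (i : Fin d) (A : Set (Fin T → Ω₁)),
    MeasurableSet[filtr Ω₁ T t ((Nat.le_succ t).trans h)] A →
      ∫ ω in A, S (t + 1) (restr Ω₁ (t + 1) h ω) i ∂Q
        = ∫ ω in A, S t (restr Ω₁ t ((Nat.le_succ t).trans h) ω) i ∂Q)

/-- The martingale measures `Q ⋘ PP` consistent with the option prices:
`𝒬 = {Q ⋘ PP : S is a Q-martingale, E_Q[gⁱ] = 0}`. -/
def QSet {T d e : ℕ} (PP : Set (Measure (Fin T → Ω₁)))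
    (S : (t : ℕ) → (Fin t → Ω₁) → Fin d → ℝ) (g : Fin e → (Fin T → Ω₁) → ℝ) :
    Set (Measure (Fin T → Ω₁)) :=
  {Q | IsProbabilityMeasure Q ∧ (∃ P ∈ PP, Q ≪ P) ∧ IsMartMeas Ω₁ S Q ∧
    ∀ i : Fin e, expec Q (g i) = 0}

/-- The no-arbitrage condition `NA(PP)` with semistatic trading in the stocks `S`
and the options `g`. -/
def NA {T d e : ℕ} (PP : Set (Measure (Fin T → Ω₁)))
    (S : (t : ℕ) → (Fin t → Ω₁) → Fin d → ℝ) (g : Fin e → (Fin T → Ω₁) → ℝ) : Prop :=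
  ∀ H : (u : ℕ) → (Fin u → Ω₁) → Fin d → ℝ, Pred Ω₁ d H → ∀ h : Fin e → ℝ,
    QuasiSure PP (univComp (Fin T → Ω₁))
      (fun ω => 0 ≤ gain Ω₁ S H T le_rfl ω + ∑ i, h i * g i ω) →
    QuasiSure PP (univComp (Fin T → Ω₁))
      (fun ω => gain Ω₁ S H T le_rfl ω + ∑ i, h i * g i ω = 0)

/-- The minimal semistatic superhedging price, valued in `EReal` (`inf ∅ = +∞`). -/
def superPrice {T d e : ℕ} (PP : Set (Measure (Fin T → Ω₁)))
    (S : (t : ℕ) → (Fin t → Ω₁) → Fin d → ℝ) (g : Fin e → (Fin T → Ω₁) → ℝ)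
    (f : (Fin T → Ω₁) → ℝ) : EReal :=
  sInf ((fun x : ℝ => (x : EReal)) ''
    {x : ℝ | ∃ H : (u : ℕ) → (Fin u → Ω₁) → Fin d → ℝ, ∃ h : Fin e → ℝ, Pred Ω₁ d H ∧
      QuasiSure PP (univComp (Fin T → Ω₁))
        (fun ω => f ω ≤ x + gain Ω₁ S H T le_rfl ω + ∑ i, h i * g i ω)})

/-- `f` is replicable by semistatic trading. -/
def Replicable {T d e : ℕ} (PP : Set (Measure (Fin T → Ω₁)))
    (S : (t : ℕ) → (Fin t → Ω₁) → Fin d → ℝ) (g : Fin e → (Fin T → Ω₁) → ℝ)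
    (f : (Fin T → Ω₁) → ℝ) : Prop :=
  ∃ x : ℝ, ∃ H : (u : ℕ) → (Fin u → Ω₁) → Fin d → ℝ, ∃ h : Fin e → ℝ, Pred Ω₁ d H ∧
    QuasiSure PP (univComp (Fin T → Ω₁))
      (fun ω => x + gain Ω₁ S H T le_rfl ω + ∑ i, h i * g i ω = f ω)

/-- The one-period increment `ΔS_{t+1}(ω, ·)` of the stock, given history `ω ∈ Ω_t`. -/
def incr {d : ℕ} (S : (t : ℕ) → (Fin t → Ω₁) → Fin d → ℝ) (t : ℕ) (ω : Fin t → Ω₁)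
    (x : Ω₁) : Fin d → ℝ :=
  fun i => S (t + 1) (Fin.snoc ω x) i - S t ω i

/-- The one-step martingale measures `𝒬_t(ω)` dominated by `𝒫_t(ω)`. -/
def Q1fam {d : ℕ} (Pt : (t : ℕ) → (Fin t → Ω₁) → Set (ProbabilityMeasure Ω₁))
    (S : (t : ℕ) → (Fin t → Ω₁) → Fin d → ℝ) (t : ℕ) (ω : Fin t → Ω₁) :
    Set (ProbabilityMeasure Ω₁) :=
  {Q | (∃ P' ∈ Pt t ω, (Q : Measure Ω₁) ≪ (P' : Measure Ω₁)) ∧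
    ∀ i, expec (Q : Measure Ω₁) (fun x => incr Ω₁ S t ω x i) = 0}

/-- `V` is a `Q`-supermartingale with respect to the filtration `(ℱ_t)`:
each `V_t` is `Q`-integrable and `E_Q[V_{t+1} | ℱ_t] ≤ V_t`. -/
def IsSupermart {T : ℕ} (V : ℕ → (Fin T → Ω₁) → ℝ) (Q : Measure (Fin T → Ω₁)) : Prop :=
  (∀ t : ℕ, t ≤ T → Integrable (V t) Q) ∧
  ∀ (t : ℕ) (h : t + 1 ≤ T) (A : Set (Fin T → Ω₁)),
    MeasurableSet[filtr Ω₁ T t ((Nat.le_succ t).trans h)] A →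
      ∫ ω in A, V (t + 1) ω ∂Q ≤ ∫ ω in A, V t ω ∂Q

end Polish

/-! ### Quasi-sure supports -/

/-- The quasi-sure support of a family of measures on `ℝ^d`. -/
def qsSupp {d : ℕ} (Rs : Set (Measure (Fin d → ℝ))) : Set (Fin d → ℝ) :=
  ⋂₀ {A : Set (Fin d → ℝ) | IsClosed A ∧ ∀ R ∈ Rs, R A = 1}

end BN

namespace BN

/-! ### Probability measures on a Polish space -/

section WeakTopology

/-- The evaluation of probability measures is measurable for the Borel structure of the
weak topology. -/
theorem measurable_toMeasure_borel {X : Type*} [TopologicalSpace X]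
    [TopologicalSpace.MetrizableSpace X] [MeasurableSpace X] [BorelSpace X] :
    Measurable[borel (ProbabilityMeasure X)] (fun μ : ProbabilityMeasure X => (μ : Measure X)) := by
  borelize (ProbabilityMeasure X)
  let _ := TopologicalSpace.metrizableSpaceMetric X
  refine Measurable.measure_of_isPiSystem_of_isProbabilityMeasure
    (S := {s : Set X | IsOpen s}) (BorelSpace.measurable_eq) isPiSystem_isOpen fun s hs => ?_
  refine LowerSemicontinuous.measurable ?_
  refine lowerSemicontinuous_iff_le_liminf.2 fun μ => ?_
  exact ProbabilityMeasure.le_liminf_measure_open_of_tendsto (L := 𝓝 μ) tendsto_id hs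

/-- Pushing forward along a topological embedding is inducing for the weak topologies. -/
theorem isInducing_map_of_isEmbedding {X Y : Type*} [TopologicalSpace X]
    [MeasurableSpace X] [BorelSpace X] [TopologicalSpace Y]
    [TopologicalSpace.MetrizableSpace Y] [SecondCountableTopology Y] [MeasurableSpace Y]
    [BorelSpace Y] {e : X → Y} (he : IsEmbedding e) :
    IsInducing (fun μ : ProbabilityMeasure X =>
      μ.map (f := e) he.continuous.measurable.aemeasurable) := by
  let _ := TopologicalSpace.metrizableSpaceMetric Y
  have hcont := ProbabilityMeasure.continuous_map he.continuous
  refine isInducing_iff_nhds.2 fun μ => le_antisymm (hcont.tendsto μ).le_comap ?_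
  have : Tendsto (fun ν : ProbabilityMeasure X => ν)
      (comap (fun ν : ProbabilityMeasure X =>
        ν.map (f := e) he.continuous.measurable.aemeasurable)
        (𝓝 (μ.map (f := e) he.continuous.measurable.aemeasurable))) (𝓝 μ) := by
    refine tendsto_of_forall_isOpen_le_liminf' fun G hG => ?_
    obtain ⟨V, hV, rfl⟩ := he.isInducing.isOpen_iff.1 hG
    have h := ProbabilityMeasure.le_liminf_measure_open_of_tendsto
      (tendsto_comap (f := fun ν : ProbabilityMeasure X =>
        ν.map (f := e) he.continuous.measurable.aemeasurable)
        (x := 𝓝 (μ.map (f := e) he.continuous.measurable.aemeasurable))) hV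
    simpa [Measure.map_apply he.continuous.measurable hV.measurableSet] using h
  simpa [Tendsto] using this

/-- The space of probability measures on a Polish space is analytic. -/
theorem analyticSet_univ_probabilityMeasure (X : Type*) [TopologicalSpace X] [PolishSpace X]
    [MeasurableSpace X] [BorelSpace X] : AnalyticSet (univ : Set (ProbabilityMeasure X)) := by
  let _ := TopologicalSpace.metrizableSpaceMetric X
  obtain ⟨e, he⟩ := Metric.PiNatEmbed.exists_embedding_to_hilbert_cube (X := X)
  have hemb : MeasurableEmbedding e := he.continuous.measurableEmbedding he.injective
  let F : ProbabilityMeasure X → ProbabilityMeasure (ℕ → unitInterval) :=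
    fun μ => μ.map (f := e) he.continuous.measurable.aemeasurable
  have hF : IsInducing F := isInducing_map_of_isEmbedding he
  have hinj : Function.Injective F := hF.injective
  have hpolish : PolishSpace (ProbabilityMeasure (ℕ → unitInterval)) := by
    let _ := TopologicalSpace.metrizableSpaceMetric (ProbabilityMeasure (ℕ → unitInterval))
    infer_instance
  borelize (ProbabilityMeasure (ℕ → unitInterval))
  have hrange : range F = {ν : ProbabilityMeasure (ℕ → unitInterval) |
      (ν : Measure (ℕ → unitInterval)) (range e)ᶜ = 0} := by
    ext ν
    constructor
    · rintro ⟨μ, rfl⟩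
      simp [F, Measure.map_apply he.continuous.measurable hemb.measurableSet_range.compl]
    · intro hν
      have hmap : Measure.map e (Measure.comap e (ν : Measure (ℕ → unitInterval))) = ν := by
        rw [hemb.map_comap]
        exact Measure.restrict_eq_self_of_ae_mem hν
      have hp : IsProbabilityMeasure (Measure.comap e (ν : Measure (ℕ → unitInterval))) := by
        constructor
        have := congrArg (fun m => m univ) hmap
        simpa [Measure.map_apply he.continuous.measurable MeasurableSet.univ] using this
      refine ⟨⟨_, hp⟩, ?_⟩
      apply ProbabilityMeasure.toMeasure_injective
      exact (ProbabilityMeasure.toMeasure_map _ _).trans hmap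
  have hmeas : MeasurableSet (range F) := by
    rw [hrange]
    exact ((Measure.measurable_coe hemb.measurableSet_range.compl).comp
      measurable_toMeasure_borel) (measurableSet_singleton 0)
  obtain ⟨Z, _, _, j, hj, hjr⟩ := analyticSet_iff_exists_polishSpace_range.1 hmeas.analyticSet
  have hk : ∀ z, ∃ μ, F μ = j z := fun z => by
    have : j z ∈ range F := hjr ▸ mem_range_self z
    exact this
  choose k hk using hk
  have hkc : Continuous k := hF.continuous_iff.2 (by
    have : F ∘ k = j := funext hk
    rwa [this])
  have hkr : range k = univ := by
    refine eq_univ_of_forall fun μ => ?_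
    obtain ⟨z, hz⟩ : F μ ∈ range j := hjr ▸ mem_range_self μ
    exact ⟨z, hinj ((hk z).trans hz)⟩
  rw [← hkr]
  exact analyticSet_range_of_polishSpace hkc

end WeakTopology
end BN

namespace BN

/-! ### Analytic sets are universally measurable -/

/-- Every analytic set is approximated from inside by compact sets, in outer measure. -/
theorem exists_isCompact_subset_range_lt {X : Type*} [TopologicalSpace X] [MeasurableSpace X]
    (μ : Measure X) [μ.OuterRegular] {f : (ℕ → ℕ) → X} (hf : Continuous f)
    {r : ℝ≥0∞} (hr : r < μ (range f)) :
    ∃ K ⊆ range f, IsCompact K ∧ r ≤ μ K := by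
  -- `C n m` is the set of sequences bounded by `m` in the first `n` coordinates.
  let C : ℕ → (ℕ → ℕ) → Set (ℕ → ℕ) := fun n m => {x | ∀ i < n, x i ≤ m i}
  have step : ∀ n (m : ℕ → ℕ), r < μ (f '' C n m) →
      ∃ j, r < μ (f '' (C n m ∩ {x | x n ≤ j})) := by
    intro n m h
    have hU : f '' C n m = ⋃ j, f '' (C n m ∩ {x | x n ≤ j}) := by
      rw [← image_iUnion, ← inter_iUnion, iUnion_eq_univ_iff.2 fun x => ⟨x n, le_refl (x n)⟩,
        inter_univ]
    have hmono : Monotone fun j => f '' (C n m ∩ {x | x n ≤ j}) := fun i j hij =>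
      image_mono (inter_subset_inter_right _ fun x hx => le_trans hx hij)
    rw [hU, hmono.measure_iUnion] at h
    exact lt_iSup_iff.1 h
  choose! J hJ using step
  let p : ℕ → ℕ → ℕ := fun n => Nat.rec (fun _ => 0) (fun n q => Function.update q n (J n q)) n
  have hp_succ : ∀ n, p (n + 1) = Function.update (p n) n (J n (p n)) := fun n => rfl
  have hCp : ∀ n, C (n + 1) (p (n + 1)) = C n (p n) ∩ {x | x n ≤ J n (p n)} := by
    intro n
    ext x
    simp only [C, hp_succ, mem_ofPred_eq, mem_inter_iff, Nat.lt_succ_iff_lt_or_eq, or_imp,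
      forall_and, forall_eq, Function.update_self]
    refine and_congr_left fun _ => forall₂_congr fun i hi => ?_
    rw [Function.update_of_ne hi.ne]
  have hlt : ∀ n, r < μ (f '' C n (p n)) := by
    intro n
    induction n with
    | zero => simpa [C] using hr
    | succ n ih => rw [hCp]; exact hJ n _ ih
  let m : ℕ → ℕ := fun n => J n (p n)
  have hpm : ∀ n, C n (p n) = C n m := by
    intro n
    induction n with
    | zero => simp [C]
    | succ n ih =>
      rw [hCp, ih]
      ext x
      simp only [C, m, mem_ofPred_eq, mem_inter_iff, Nat.lt_succ_iff_lt_or_eq, or_imp,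
        forall_and, forall_eq]
  have hK : IsCompact (pi univ fun i => Iic (m i)) :=
    isCompact_univ_pi fun i => (finite_Iic (m i)).isCompact
  refine ⟨f '' pi univ fun i => Iic (m i), image_subset_range _ _, hK.image hf, ?_⟩
  rw [Set.measure_eq_iInf_isOpen]
  refine le_iInf₂ fun U hU => le_iInf fun hUo => ?_
  suffices ∃ n, C n m ⊆ f ⁻¹' U by
    obtain ⟨n, hn⟩ := this
    exact (hlt n).le.trans (measure_mono (by rw [hpm]; exact image_subset_iff.2 hn))
  by_contra! hcon
  have hcon' : ∀ n, ∃ x ∈ C n m, f x ∉ U := fun n => by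
    simpa [not_subset] using hcon n
  choose x hxC hxU using hcon'
  -- Truncating the points outside `U` produces a sequence in the compact box.
  let y : ℕ → ℕ → ℕ := fun n i => min (x n i) (m i)
  have hy : ∀ n, y n ∈ pi univ fun i => Iic (m i) := fun n i _ => mem_Iic.2 (min_le_right _ _)
  obtain ⟨a, ha, φ, hφ, hlim⟩ := hK.tendsto_subseq hy
  have hlim' : Tendsto (fun n => x (φ n)) atTop (𝓝 a) := by
    rw [tendsto_pi_nhds] at hlim ⊢
    intro i
    refine (hlim i).congr' ?_
    filter_upwards [eventually_gt_atTop i] with n hn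
    exact min_eq_left (hxC (φ n) i (hn.trans_le (hφ.id_le n)))
  have haU : f a ∈ U := hU (mem_image_of_mem f ha)
  obtain ⟨n, hn⟩ := (((hf.tendsto a).comp hlim').eventually (hUo.mem_nhds haU)).exists
  exact hxU _ hn

/-- Analytic subsets of a metrizable space are universally measurable. -/
theorem measurableSet_univComp_of_analyticSet {X : Type*} [TopologicalSpace X]
    [TopologicalSpace.MetrizableSpace X] [MeasurableSpace X] [BorelSpace X] {A : Set X}
    (hA : AnalyticSet A) : MeasurableSet[univComp X] A := by
  intro μ hμ
  rw [AnalyticSet] at hA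
  rcases hA with rfl | ⟨f, hf, rfl⟩
  · exact MeasurableSet.empty.nullMeasurableSet
  let _ := TopologicalSpace.metrizableSpaceMetric X
  by_cases h0 : μ (range f) = 0
  · exact NullMeasurableSet.of_null h0
  obtain ⟨u, -, hu, hulim⟩ := exists_seq_strictMono_tendsto' (pos_iff_ne_zero.2 h0)
  choose K hKsub hKc hKm using fun n => exists_isCompact_subset_range_lt μ hf (hu n).2
  have hKmeas : MeasurableSet (⋃ n, K n) := MeasurableSet.iUnion fun n => (hKc n).measurableSet
  have hsub : (⋃ n, K n) ⊆ range f := iUnion_subset hKsub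
  have hle : μ (range f) ≤ μ (⋃ n, K n) :=
    le_of_tendsto' hulim fun n => (hKm n).trans (measure_mono (subset_iUnion K n))
  exact hKmeas.nullMeasurableSet.congr
    (ae_eq_of_subset_of_measure_ge hsub hle hKmeas.nullMeasurableSet (measure_ne_top _ _))

/-! ### Uniformization of analytic sets -/

/-- The sequences extending the reversed finite sequence `l`. -/
def extending : List ℕ → Set (ℕ → ℕ)
  | [] => univ
  | j :: l => extending l ∩ {x | x l.length = j}

theorem isClosed_extending (l : List ℕ) : IsClosed (extending l) := by
  induction l with
  | nil => exact isClosed_univ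
  | cons j l ih => exact ih.inter (isClosed_eq (continuous_apply _) continuous_const)

section Branch

variable {X : Type*} (B : List ℕ → Set X)

/-- The leftmost branch, truncated at level `n` and written in reversed order, of the tree of
all `l` with `x ∈ B l`. -/
def branchPrefix (x : X) : ℕ → List ℕ
  | 0 => []
  | n + 1 => sInf {j | x ∈ B (j :: branchPrefix x n)} :: branchPrefix x n

/-- The leftmost branch of the tree of all `l` with `x ∈ B l`. -/
def branch (x : X) (n : ℕ) : ℕ := sInf {j | x ∈ B (j :: branchPrefix B x n)}

theorem branchPrefix_length (x : X) (n : ℕ) : (branchPrefix B x n).length = n := by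
  induction n with
  | zero => rfl
  | succ n ih => simp [branchPrefix, ih]

theorem eq_branch_of_mem_extending {x : X} {n : ℕ} {z : ℕ → ℕ}
    (hz : z ∈ extending (branchPrefix B x n)) {i : ℕ} (hi : i < n) : z i = branch B x i := by
  induction n with
  | zero => exact absurd hi (Nat.not_lt_zero i)
  | succ n ih =>
    rcases Nat.lt_succ_iff_lt_or_eq.1 hi with h | rfl
    · exact ih hz.1 h
    · have := hz.2
      rwa [mem_ofPred_eq, branchPrefix_length] at this

theorem measurable_sInf_mem {m : MeasurableSpace X} {s : ℕ → Set X}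
    (hs : ∀ j, MeasurableSet (s j)) : Measurable fun x => sInf {j | x ∈ s j} := by
  classical
  refine measurable_of_Iic fun k => ?_
  have : (fun x => sInf {j | x ∈ s j}) ⁻¹' Iic k = (⋃ j ∈ Iic k, s j) ∪ (⋃ j, s j)ᶜ := by
    ext x
    simp only [mem_preimage, mem_Iic, mem_union, mem_iUnion, mem_compl_iff, exists_prop]
    constructor
    · intro h
      by_cases hx : ∃ j, x ∈ s j
      · exact Or.inl ⟨_, h, Nat.sInf_mem (s := {j | x ∈ s j}) hx⟩
      · exact Or.inr hx
    · rintro (⟨j, hj, hx⟩ | hx)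
      · exact (Nat.sInf_le hx).trans hj
      · have : {j | x ∈ s j} = ∅ := eq_empty_of_forall_notMem fun j hj => hx ⟨j, hj⟩
        simp [this]
  rw [this]
  exact (MeasurableSet.biUnion (to_countable _) fun j _ => hs j).union
    (MeasurableSet.iUnion hs).compl

theorem measurableSet_branchPrefix_eq {m : MeasurableSpace X} (hB : ∀ l, MeasurableSet (B l))
    (n : ℕ) (l : List ℕ) : MeasurableSet {x | branchPrefix B x n = l} := by
  induction n generalizing l with
  | zero => simp [branchPrefix]
  | succ n ih =>
    cases l with
    | nil => simp [branchPrefix]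
    | cons j l =>
      have : {x | branchPrefix B x (n + 1) = j :: l} =
          {x | branchPrefix B x n = l} ∩ (fun x => sInf {j | x ∈ B (j :: l)}) ⁻¹' {j} := by
        ext x
        simp only [branchPrefix, List.cons.injEq, mem_ofPred_eq, mem_inter_iff, mem_preimage,
          mem_singleton_iff]
        constructor
        · rintro ⟨h, rfl⟩
          exact ⟨rfl, h⟩
        · rintro ⟨rfl, h⟩
          exact ⟨h, rfl⟩
      rw [this]
      exact (ih l).inter (measurable_sInf_mem (fun j => hB (j :: l)) (measurableSet_singleton j))

theorem measurable_branch {m : MeasurableSpace X} (hB : ∀ l, MeasurableSet (B l)) :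
    Measurable (branch B) := by
  refine measurable_pi_iff.2 fun n => measurable_to_countable' fun j => ?_
  have : (fun x => branch B x n) ⁻¹' {j} =
      ⋃ l : List ℕ, {x | branchPrefix B x (n + 1) = j :: l} := by
    ext x
    simp [branchPrefix, branch]
  rw [this]
  exact MeasurableSet.iUnion fun l => measurableSet_branchPrefix_eq B hB _ _

end Branch

/-- If `φ` is continuous on the Baire space, its leftmost preimages form a section of `φ`. -/
theorem apply_branch_eq {X : Type*} [TopologicalSpace X] [T2Space X] {φ : (ℕ → ℕ) → X}
    (hφ : Continuous φ) {x : X} (hx : x ∈ range φ) :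
    φ (branch (fun l => φ '' extending l) x) = x := by
  set B : List ℕ → Set X := fun l => φ '' extending l with hB
  have hmem : ∀ n, x ∈ B (branchPrefix B x n) := by
    intro n
    induction n with
    | zero => simpa [hB, branchPrefix, extending] using hx
    | succ n ih =>
      obtain ⟨z, hz, hzx⟩ := ih
      exact Nat.sInf_mem (s := {j | x ∈ B (j :: branchPrefix B x n)})
        ⟨z (branchPrefix B x n).length, z, ⟨hz, rfl⟩, hzx⟩
  choose z hz hzx using hmem
  have hlim : Tendsto z atTop (𝓝 (branch B x)) := by
    refine tendsto_pi_nhds.2 fun i => tendsto_const_nhds.congr' ?_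
    filter_upwards [eventually_gt_atTop i] with n hn
    exact (eq_branch_of_mem_extending B (hz n) hn).symm
  have h := (hφ.tendsto _).comp hlim
  refine tendsto_nhds_unique h (tendsto_const_nhds.congr fun n => (hzx n).symm)

/-- **Jankov–von Neumann uniformization**: an analytic set admits a universally measurable
section over its projection. -/
theorem exists_measurable_univComp_section {X Y : Type*} [TopologicalSpace X]
    [TopologicalSpace.MetrizableSpace X] [MeasurableSpace X] [BorelSpace X] [TopologicalSpace Y]
    [Nonempty Y] {A : Set (X × Y)} (hA : AnalyticSet A) :
    ∃ σ : X → Y, Measurable[univComp X, borel Y] σ ∧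
      ∀ x ∈ Prod.fst '' A, (x, σ x) ∈ A := by
  rw [AnalyticSet] at hA
  rcases hA with rfl | ⟨f, hf, rfl⟩
  · exact ⟨fun _ => Classical.arbitrary Y, @measurable_const _ _ (borel Y) (univComp X) _, by simp⟩
  have hφ : Continuous fun z => (f z).1 := continuous_fst.comp hf
  let B : List ℕ → Set X := fun l => (fun z => (f z).1) '' extending l
  have hB : ∀ l, MeasurableSet[univComp X] (B l) := fun l =>
    measurableSet_univComp_of_analyticSet
      ((isClosed_extending l).analyticSet.image_of_continuous hφ)
  refine ⟨fun x => (f (branch B x)).2, ?_, ?_⟩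
  · borelize Y
    exact (continuous_snd.comp hf).measurable.comp (measurable_branch B hB)
  · rintro x ⟨_, ⟨z, rfl⟩, rfl⟩
    refine ⟨branch B (f z).1, Prod.ext ?_ rfl⟩
    exact apply_branch_eq hφ ⟨z, rfl⟩

end BN

namespace BN

/-! ### One-period martingale measures -/

section OnePeriodMartingale

variable {Ω : Type*} [MeasurableSpace Ω] {d : ℕ}

/-- A positive increasing smooth convex function with slope in `(0, 2)` lying above the
positive part. -/
def softPlus (u : ℝ) : ℝ := √(1 + u ^ 2) + u

/-- The derivative of `softPlus`. -/
def softPlusDeriv (u : ℝ) : ℝ := u / √(1 + u ^ 2) + 1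

theorem hasDerivAt_softPlus (u : ℝ) : HasDerivAt softPlus (softPlusDeriv u) u := by
  have h : HasDerivAt (fun u : ℝ => 1 + u ^ 2) (2 * u) u := by
    simpa using (hasDerivAt_pow 2 u).const_add 1
  refine ((h.sqrt (by positivity)).add (hasDerivAt_id u)).congr_deriv ?_
  unfold softPlusDeriv
  have : √(1 + u ^ 2) ≠ 0 := by positivity
  field_simp

theorem abs_lt_sqrt_one_add_sq (u : ℝ) : |u| < √(1 + u ^ 2) := by
  rw [← Real.sqrt_sq_eq_abs]
  exact Real.sqrt_lt_sqrt (sq_nonneg u) (by linarith)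

theorem softPlusDeriv_mem_Ioo (u : ℝ) : softPlusDeriv u ∈ Ioo (0 : ℝ) 2 := by
  have h : |u / √(1 + u ^ 2)| < 1 := by
    rw [abs_div, abs_of_nonneg (Real.sqrt_nonneg _)]
    exact (div_lt_one (by positivity)).2 (abs_lt_sqrt_one_add_sq u)
  rw [abs_lt] at h
  unfold softPlusDeriv
  constructor <;> linarith

theorem continuous_softPlusDeriv : Continuous softPlusDeriv := by
  unfold softPlusDeriv
  have (u : ℝ) : √(1 + u ^ 2) ≠ 0 := by positivity
  fun_prop (disch := assumption)

theorem max_zero_le_softPlus (u : ℝ) : max u 0 ≤ softPlus u := by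
  have h := abs_lt.1 (abs_lt_sqrt_one_add_sq u)
  unfold softPlus
  exact max_le (by linarith [Real.sqrt_nonneg (1 + u ^ 2)]) (by linarith)

theorem lipschitzWith_softPlus : LipschitzWith 2 softPlus := by
  refine lipschitzWith_of_nnnorm_deriv_le (fun u => (hasDerivAt_softPlus u).differentiableAt)
    fun u => ?_
  rw [(hasDerivAt_softPlus u).deriv, ← NNReal.coe_le_coe, coe_nnnorm, Real.norm_eq_abs]
  have h := softPlusDeriv_mem_Ioo u
  rw [abs_of_pos h.1]
  exact h.2.le

theorem abs_dotProduct_le (y x : Fin d → ℝ) : |y ⬝ᵥ x| ≤ d * ‖y‖ * ‖x‖ := by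
  calc |y ⬝ᵥ x| ≤ ∑ i, |y i * x i| := Finset.abs_sum_le_sum_abs _ _
    _ ≤ ∑ _i : Fin d, ‖y‖ * ‖x‖ := by
        refine Finset.sum_le_sum fun i _ => ?_
        rw [abs_mul]
        exact mul_le_mul (norm_le_pi_norm y i) (norm_le_pi_norm x i) (abs_nonneg _) (norm_nonneg _)
    _ = d * ‖y‖ * ‖x‖ := by simp [mul_assoc]

theorem measurable_dotProduct_const {X : Ω → Fin d → ℝ} (hX : Measurable X) (y : Fin d → ℝ) :
    Measurable fun ω => y ⬝ᵥ X ω := by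
  simp only [dotProduct]
  fun_prop

theorem continuous_dotProduct_left (x : Fin d → ℝ) : Continuous fun y : Fin d → ℝ => y ⬝ᵥ x := by
  simp only [dotProduct]
  fun_prop

theorem LipschitzWith.abs_le {K : ℝ≥0} {h : ℝ → ℝ} (hh : LipschitzWith K h) (u : ℝ) :
    |h u| ≤ |h 0| + K * |u| := by
  have h1 := hh.dist_le_mul u 0
  rw [Real.dist_eq, Real.dist_eq, sub_zero] at h1
  have h2 := abs_add_le (h u - h 0) (h 0)
  rw [sub_add_cancel] at h2
  linarith

theorem integrable_lipschitz_dotProduct {μ : Measure Ω} [IsFiniteMeasure μ] {X : Ω → Fin d → ℝ}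
    (hX : Measurable X) (hXint : Integrable X μ) {K : ℝ≥0} {h : ℝ → ℝ} (hh : LipschitzWith K h)
    (y : Fin d → ℝ) : Integrable (fun ω => h (y ⬝ᵥ X ω)) μ := by
  refine Integrable.mono' (g := fun ω => |h 0| + K * (d * ‖y‖ * ‖X ω‖))
    ((integrable_const _).add ((hXint.norm.const_mul _).const_mul _))
    (hh.continuous.measurable.comp (measurable_dotProduct_const hX y)).aestronglyMeasurable
    (Eventually.of_forall fun ω => ?_)
  rw [Real.norm_eq_abs]
  refine (LipschitzWith.abs_le hh _).trans ?_
  gcongr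
  exact abs_dotProduct_le y (X ω)

theorem continuous_integral_lipschitz_dotProduct {μ : Measure Ω} [IsFiniteMeasure μ]
    {X : Ω → Fin d → ℝ} (hX : Measurable X) (hXint : Integrable X μ) {K : ℝ≥0} {h : ℝ → ℝ}
    (hh : LipschitzWith K h) : Continuous fun y : Fin d → ℝ => ∫ ω, h (y ⬝ᵥ X ω) ∂μ := by
  refine continuous_iff_continuousAt.2 fun y₀ => ?_
  refine continuousAt_of_dominated (bound := fun ω => |h 0| + K * (d * (‖y₀‖ + 1) * ‖X ω‖))
    (Eventually.of_forall fun y =>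
      (integrable_lipschitz_dotProduct hX hXint hh y).aestronglyMeasurable) ?_
    ((integrable_const _).add ((hXint.norm.const_mul _).const_mul _))
    (Eventually.of_forall fun ω =>
      (hh.continuous.comp (continuous_dotProduct_left (X ω))).continuousAt)
  filter_upwards [continuous_norm.continuousAt.eventually_lt continuousAt_const
    (lt_add_one ‖y₀‖)] with y hy
  refine Eventually.of_forall fun ω => ?_
  rw [Real.norm_eq_abs]
  refine (LipschitzWith.abs_le hh _).trans ?_
  gcongr
  refine (abs_dotProduct_le y (X ω)).trans ?_
  gcongr

/-- A minimizer of the expected `softPlus` of the gains over a space of strategies without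
loss-free directions. -/
theorem exists_forall_integral_softPlus_le {μ : Measure Ω} [IsFiniteMeasure μ]
    {X : Ω → Fin d → ℝ} (hX : Measurable X) (hXint : Integrable X μ) (V : Submodule ℝ (Fin d → ℝ))
    (hV : ∀ v ∈ V, v ≠ 0 → 0 < μ {ω | v ⬝ᵥ X ω < 0}) :
    ∃ y ∈ V, ∀ v ∈ V, ∫ ω, softPlus (y ⬝ᵥ X ω) ∂μ ≤ ∫ ω, softPlus (v ⬝ᵥ X ω) ∂μ := by
  have hpos : LipschitzWith 1 fun u : ℝ => max u 0 := LipschitzWith.id.max_const 0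
  have hsoft := integrable_lipschitz_dotProduct hX hXint lipschitzWith_softPlus
  suffices ∃ y : V, ∀ v : V, ∫ ω, softPlus ((y : Fin d → ℝ) ⬝ᵥ X ω) ∂μ ≤
      ∫ ω, softPlus ((v : Fin d → ℝ) ⬝ᵥ X ω) ∂μ by
    obtain ⟨y, hy⟩ := this
    exact ⟨y, y.2, fun v hv => hy ⟨v, hv⟩⟩
  rcases subsingleton_or_nontrivial V with hs | hn
  · exact ⟨0, fun v => by rw [Subsingleton.elim v 0]⟩
  have hcont : Continuous fun y : V => ∫ ω, max ((y : Fin d → ℝ) ⬝ᵥ X ω) 0 ∂μ :=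
    (continuous_integral_lipschitz_dotProduct hX hXint hpos).comp continuous_subtype_val
  obtain ⟨y₀, hy₀, hmin⟩ := (isCompact_sphere (0 : V) 1).exists_isMinOn
    (NormedSpace.sphere_nonempty.2 zero_le_one) hcont.continuousOn
  set c := ∫ ω, max ((y₀ : Fin d → ℝ) ⬝ᵥ X ω) 0 ∂μ with hc
  have hcpos : 0 < c := by
    rw [hc, integral_pos_iff_support_of_nonneg
      (f := fun ω => max ((y₀ : Fin d → ℝ) ⬝ᵥ X ω) 0) (fun ω => le_max_right _ _)
      (integrable_lipschitz_dotProduct hX hXint hpos _)]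
    have hne : -(y₀ : Fin d → ℝ) ≠ 0 := by
      intro h
      have : y₀ = 0 := by simpa using h
      simp [this] at hy₀
    refine (hV _ (V.neg_mem y₀.2) hne).trans_le (measure_mono fun ω hω => ?_)
    have : 0 < (y₀ : Fin d → ℝ) ⬝ᵥ X ω := by simpa using hω
    simp [Function.mem_support, max_eq_left this.le, this.ne']
  have hbound : ∀ y : V, c * ‖y‖ ≤ ∫ ω, softPlus ((y : Fin d → ℝ) ⬝ᵥ X ω) ∂μ := by
    intro y
    have h1 : ∫ ω, max ((y : Fin d → ℝ) ⬝ᵥ X ω) 0 ∂μ ≤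
        ∫ ω, softPlus ((y : Fin d → ℝ) ⬝ᵥ X ω) ∂μ :=
      integral_mono (integrable_lipschitz_dotProduct hX hXint hpos _) (hsoft _)
        fun ω => max_zero_le_softPlus _
    refine le_trans ?_ h1
    rcases eq_or_ne y 0 with rfl | hy
    · simp
    have hny : 0 < ‖y‖ := norm_pos_iff.2 hy
    have h2 := hmin (show ‖y‖⁻¹ • y ∈ Metric.sphere (0 : V) 1 from
      mem_sphere_zero_iff_norm.2 (by
        rw [norm_smul, norm_inv, norm_norm, inv_mul_cancel₀ hny.ne']))
    have h3 : ∀ ω, max (((‖y‖⁻¹ • y : V) : Fin d → ℝ) ⬝ᵥ X ω) 0 =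
        ‖y‖⁻¹ * max ((y : Fin d → ℝ) ⬝ᵥ X ω) 0 := fun ω => by
      rw [Submodule.coe_smul, smul_dotProduct, smul_eq_mul, mul_max_of_nonneg _ _ (by positivity),
        mul_zero]
    simp only [mem_ofPred_eq, h3, integral_const_mul] at h2
    rw [inv_mul_eq_div, le_div_iff₀ hny] at h2
    exact h2
  refine Continuous.exists_forall_le
    ((continuous_integral_lipschitz_dotProduct hX hXint lipschitzWith_softPlus).comp
      continuous_subtype_val) ?_
  exact tendsto_atTop_mono hbound ((tendsto_norm_cocompact_atTop (E := V)).const_mul_atTop hcpos)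

/-- A positive bounded density turning the gains of all strategies in `V` into zero-mean
random variables. -/
theorem exists_martingale_density_of_integrable {μ : Measure Ω} [IsFiniteMeasure μ]
    {X : Ω → Fin d → ℝ} (hX : Measurable X) (hXint : Integrable X μ) (V : Submodule ℝ (Fin d → ℝ))
    (hV : ∀ v ∈ V, v ≠ 0 → 0 < μ {ω | v ⬝ᵥ X ω < 0}) :
    ∃ g : Ω → ℝ, Measurable g ∧ (∀ ω, g ω ∈ Ioo (0 : ℝ) 2) ∧
      ∀ v ∈ V, ∫ ω, g ω * (v ⬝ᵥ X ω) ∂μ = 0 := by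
  obtain ⟨y, hyV, hy⟩ := exists_forall_integral_softPlus_le hX hXint V hV
  refine ⟨fun ω => softPlusDeriv (y ⬝ᵥ X ω),
    continuous_softPlusDeriv.measurable.comp (measurable_dotProduct_const hX y),
    fun ω => softPlusDeriv_mem_Ioo _, fun v hv => ?_⟩
  have hsoft := integrable_lipschitz_dotProduct hX hXint lipschitzWith_softPlus
  have hder := hasDerivAt_integral_of_dominated_loc_of_deriv_le (μ := μ) (x₀ := (0 : ℝ))
    (s := univ) (F := fun s ω => softPlus ((y + s • v) ⬝ᵥ X ω))
    (F' := fun s ω => softPlusDeriv ((y + s • v) ⬝ᵥ X ω) * (v ⬝ᵥ X ω))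
    (bound := fun ω => 2 * |v ⬝ᵥ X ω|) univ_mem
    (Eventually.of_forall fun s => (hsoft (y + s • v)).aestronglyMeasurable)
    (hsoft _)
    ((continuous_softPlusDeriv.measurable.comp (measurable_dotProduct_const hX _)).mul
      (measurable_dotProduct_const hX v)).aestronglyMeasurable
    (Eventually.of_forall fun ω s _ => by
      rw [norm_mul, Real.norm_eq_abs, Real.norm_eq_abs,
        abs_of_pos (softPlusDeriv_mem_Ioo _).1]
      exact mul_le_mul_of_nonneg_right (softPlusDeriv_mem_Ioo _).2.le (abs_nonneg _))
    ((integrable_lipschitz_dotProduct hX hXint LipschitzWith.id v).abs.const_mul 2)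
    (Eventually.of_forall fun ω s _ => by
      have hlin : HasDerivAt (fun s : ℝ => (y + s • v) ⬝ᵥ X ω) (v ⬝ᵥ X ω) s := by
        simp only [add_dotProduct, smul_dotProduct, smul_eq_mul]
        simpa using ((hasDerivAt_id s).mul_const (v ⬝ᵥ X ω)).const_add (y ⬝ᵥ X ω)
      exact (hasDerivAt_softPlus _).comp s hlin)
  have hmin : IsLocalMin (fun s : ℝ => ∫ ω, softPlus ((y + s • v) ⬝ᵥ X ω) ∂μ) 0 :=
    Eventually.of_forall fun s => by
      simpa using hy _ (V.add_mem hyV (V.smul_mem s hv))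
  simpa using hmin.hasDerivAt_eq_zero hder.2

/-- An equivalent probability measure under which the gains of all strategies in `V` are
integrable with mean zero. -/
theorem exists_equivalent_martingale_measure (μ : Measure Ω) [IsProbabilityMeasure μ]
    {X : Ω → Fin d → ℝ} (hX : Measurable X) (V : Submodule ℝ (Fin d → ℝ))
    (hV : ∀ v ∈ V, v ≠ 0 → 0 < μ {ω | v ⬝ᵥ X ω < 0}) :
    ∃ Q : ProbabilityMeasure Ω, μ ≪ (Q : Measure Ω) ∧ (Q : Measure Ω) ≪ μ ∧
      Integrable X (Q : Measure Ω) ∧ ∀ v ∈ V, ∫ ω, v ⬝ᵥ X ω ∂(Q : Measure Ω) = 0 := by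
  let w : Ω → ℝ := fun ω => (1 + ‖X ω‖)⁻¹
  have hw : Measurable w := (hX.norm.const_add 1).inv
  have hwpos : ∀ ω, 0 < w ω := fun ω => by positivity
  have hwle : ∀ ω, w ω ≤ 1 := fun ω => inv_le_one_of_one_le₀ (by linarith [norm_nonneg (X ω)])
  let μ₀ := μ.withDensity fun ω => ENNReal.ofReal (w ω)
  have hfin : IsFiniteMeasure μ₀ := isFiniteMeasure_withDensity_ofReal
    (Integrable.of_bound hw.aestronglyMeasurable 1 (Eventually.of_forall fun ω => by
      rw [Real.norm_eq_abs, abs_of_pos (hwpos ω)]; exact hwle ω)).2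
  have hμ₀ : μ ≪ μ₀ := withDensity_absolutelyContinuous' hw.ennreal_ofReal.aemeasurable
    (Eventually.of_forall fun ω => by simpa using hwpos ω)
  have hXint : Integrable X μ₀ := by
    rw [integrable_withDensity_iff_integrable_smul' hw.ennreal_ofReal (by simp)]
    refine Integrable.of_bound (C := 1)
      (hw.ennreal_ofReal.ennreal_toReal.smul hX).aestronglyMeasurable
      (Eventually.of_forall fun ω => ?_)
    rw [ENNReal.toReal_ofReal (hwpos ω).le, norm_smul, Real.norm_eq_abs, abs_of_pos (hwpos ω),
      inv_mul_eq_div, div_le_one (by positivity)]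
    linarith
  obtain ⟨g, hg, hgI, hgV⟩ := exists_martingale_density_of_integrable hX hXint V fun v hv hne =>
    pos_iff_ne_zero.2 fun h => (hV v hv hne).ne' (hμ₀ h)
  let ν := μ₀.withDensity fun ω => ENNReal.ofReal (g ω)
  have hν : IsFiniteMeasure ν := isFiniteMeasure_withDensity_ofReal
    (Integrable.of_bound hg.aestronglyMeasurable 2 (Eventually.of_forall fun ω => by
      rw [Real.norm_eq_abs, abs_of_pos (hgI ω).1]; exact (hgI ω).2.le)).2
  have hμν : μ ≪ ν := hμ₀.trans (withDensity_absolutelyContinuous' hg.ennreal_ofReal.aemeasurable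
    (Eventually.of_forall fun ω => by simpa using (hgI ω).1))
  have hνμ : ν ≪ μ :=
    (withDensity_absolutelyContinuous _ _).trans (withDensity_absolutelyContinuous _ _)
  have hνne : ν ≠ 0 := fun h => IsProbabilityMeasure.ne_zero μ (by
    rw [h] at hμν; exact Measure.absolutelyContinuous_zero_iff.1 hμν)
  have hνuniv : ν univ ≠ 0 := fun h => hνne (Measure.measure_univ_eq_zero.1 h)
  have : NeZero ν := ⟨hνne⟩
  have hXν : Integrable X ν := by
    rw [integrable_withDensity_iff_integrable_smul' hg.ennreal_ofReal (by simp)]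
    refine Integrable.mono' (hXint.norm.const_mul 2)
      (hg.ennreal_ofReal.ennreal_toReal.smul hX).aestronglyMeasurable
      (Eventually.of_forall fun ω => ?_)
    rw [ENNReal.toReal_ofReal (hgI ω).1.le, norm_smul, Real.norm_eq_abs, abs_of_pos (hgI ω).1]
    exact mul_le_mul_of_nonneg_right (hgI ω).2.le (norm_nonneg _)
  refine ⟨⟨(ν univ)⁻¹ • ν, isProbabilityMeasureSMul⟩, ?_, ?_, ?_, fun v hv => ?_⟩
  · exact hμν.trans (Measure.absolutelyContinuous_smul (by simp [measure_ne_top]))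
  · exact (Measure.smul_absolutelyContinuous).trans hνμ
  · exact hXν.smul_measure (by simpa using hνuniv)
  · have : ∫ ω, v ⬝ᵥ X ω ∂ν = 0 := by
      rw [integral_withDensity_eq_integral_toReal_smul hg.ennreal_ofReal (by simp)]
      simpa [ENNReal.toReal_ofReal (hgI _).1.le] using hgV v hv
    rw [ProbabilityMeasure.coe_mk, integral_smul_measure, this, smul_zero]

end OnePeriodMartingale

end BN

namespace BN

section DominatingMeasure

variable {Ω : Type*} [MeasurableSpace Ω] {d : ℕ}

theorem isOpen_measure_dotProduct_neg_pos (μ : Measure Ω) [IsFiniteMeasure μ]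
    {X : Ω → Fin d → ℝ} (hX : Measurable X) :
    IsOpen {z : Fin d → ℝ | 0 < μ {ω | z ⬝ᵥ X ω < 0}} := by
  let φ : ℝ → ℝ := fun u => min 1 (max 0 (-u))
  have hφ : Continuous φ := by fun_prop
  have hφ0 : ∀ u, 0 ≤ φ u := fun u => le_min zero_le_one (le_max_left _ _)
  have hm : ∀ z, AEStronglyMeasurable (fun ω => φ (z ⬝ᵥ X ω)) μ := fun z =>
    (hφ.measurable.comp (measurable_dotProduct_const hX z)).aestronglyMeasurable
  have hb : ∀ z, ∀ᵐ ω ∂μ, ‖φ (z ⬝ᵥ X ω)‖ ≤ 1 := fun z => Eventually.of_forall fun ω => by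
    rw [Real.norm_eq_abs, abs_of_nonneg (hφ0 _)]
    exact min_le_left _ _
  have hcont : Continuous fun z : Fin d → ℝ => ∫ ω, φ (z ⬝ᵥ X ω) ∂μ :=
    continuous_of_dominated hm hb (integrable_const 1)
      (Eventually.of_forall fun ω => hφ.comp (continuous_dotProduct_left (X ω)))
  convert isOpen_lt continuous_const hcont using 1
  ext z
  have hsupp : {ω | z ⬝ᵥ X ω < 0} = Function.support fun ω => φ (z ⬝ᵥ X ω) := by
    ext ω
    rw [Function.mem_support, mem_ofPred_eq]
    constructor
    · intro h
      exact (lt_min one_pos (lt_max_of_lt_right (neg_pos.2 h))).ne'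
    · intro h
      by_contra hn
      refine h ?_
      have : max 0 (-(z ⬝ᵥ X ω)) = 0 := max_eq_left (by linarith [not_lt.1 hn])
      simp [φ, this]
  rw [mem_ofPred_eq, mem_ofPred_eq, hsupp, integral_pos_iff_support_of_nonneg
    (f := fun ω => φ (z ⬝ᵥ X ω)) (fun ω => hφ0 _) (Integrable.of_bound (hm z) 1 (hb z))]

theorem ConvexPM.exists_dominating {C : Set (ProbabilityMeasure Ω)} (hC : ConvexPM C)
    {P : ProbabilityMeasure Ω} (hP : P ∈ C) {ι : Type*} (t : Finset ι)
    (R : ι → ProbabilityMeasure Ω) (hR : ∀ j ∈ t, R j ∈ C) :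
    ∃ P' ∈ C, (P : Measure Ω) ≪ (P' : Measure Ω) ∧
      ∀ j ∈ t, (R j : Measure Ω) ≪ (P' : Measure Ω) := by
  classical
  induction t using Finset.induction_on with
  | empty => exact ⟨P, hP, Measure.AbsolutelyContinuous.rfl, by simp⟩
  | insert j s hj ih =>
    obtain ⟨P', hP', hPP', hRP'⟩ := ih fun k hk => hR k (Finset.mem_insert_of_mem hk)
    let ν : Measure Ω := (2⁻¹ : ℝ≥0∞) • (P' : Measure Ω) + (2⁻¹ : ℝ≥0∞) • (R j : Measure Ω)
    have hν : IsProbabilityMeasure ν := ⟨by simp [ν, ENNReal.inv_two_add_inv_two]⟩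
    have h1 : (P' : Measure Ω) ≪ ν :=
      (Measure.absolutelyContinuous_smul (by simp)).trans
        (Measure.absolutelyContinuous_of_le (Measure.le_add_right le_rfl))
    have h2 : (R j : Measure Ω) ≪ ν :=
      (Measure.absolutelyContinuous_smul (by simp)).trans
        (Measure.absolutelyContinuous_of_le (Measure.le_add_left le_rfl))
    refine ⟨⟨ν, hν⟩, hC P' hP' (R j) (hR j (Finset.mem_insert_self j s)) _ _
      ENNReal.inv_two_add_inv_two _ rfl, hPP'.trans h1, fun k hk => ?_⟩
    rcases Finset.mem_insert.1 hk with rfl | hk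
    · exact h2
    · exact (hRP' k hk).trans h1

theorem quasiSure_coe_image_iff {C : Set (ProbabilityMeasure Ω)} {p : Ω → Prop}
    (hp : MeasurableSet {ω | p ω}) :
    QuasiSure ((fun P : ProbabilityMeasure Ω => (P : Measure Ω)) '' C) ‹MeasurableSpace Ω› p ↔
      ∀ R ∈ C, ∀ᵐ ω ∂(R : Measure Ω), p ω := by
  constructor
  · rintro ⟨A, -, hA, hA0⟩ R hR
    exact measure_mono_null hA (hA0 _ ⟨R, hR, rfl⟩)
  · intro h
    refine ⟨{ω | ¬ p ω}, hp.compl, subset_rfl, ?_⟩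
    rintro _ ⟨R, hR, rfl⟩
    exact h R hR

theorem expec_eq_zero_of_integral_eq_zero {Q : Measure Ω} {f : Ω → ℝ} (hf : Integrable f Q)
    (h0 : ∫ ω, f ω ∂Q = 0) : expec Q f = 0 := by
  have h1 : ∫⁻ x, ENNReal.ofReal (f x) ∂Q ≠ ⊤ := hf.lintegral_lt_top.ne
  have h2 : ∫⁻ x, ENNReal.ofReal (-f x) ∂Q ≠ ⊤ := hf.neg.lintegral_lt_top.ne
  rw [integral_eq_lintegral_pos_part_sub_lintegral_neg_part hf, sub_eq_zero,
    ENNReal.toReal_eq_toReal_iff' h1 h2] at h0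
  rw [expec, ← h0]
  exact EReal.sub_self (by simpa using h1) (by simp)

theorem expec_eq_zero_iff {Q : Measure Ω} {f : Ω → ℝ} :
    expec Q f = 0 ↔ ∫⁻ x, ENNReal.ofReal (f x) ∂Q = ∫⁻ x, ENNReal.ofReal (-f x) ∂Q ∧
      ∫⁻ x, ENNReal.ofReal (f x) ∂Q ≠ ⊤ := by
  rw [expec]
  generalize ∫⁻ x, ENNReal.ofReal (f x) ∂Q = a
  generalize ∫⁻ x, ENNReal.ofReal (-f x) ∂Q = b
  constructor
  · intro h
    rcases eq_or_ne a ⊤ with rfl | ha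
    · rcases eq_or_ne b ⊤ with rfl | hb
      · simp at h
      · lift b to ℝ≥0 using hb
        simp at h
    · rcases eq_or_ne b ⊤ with rfl | hb
      · lift a to ℝ≥0 using ha
        simp at h
      · refine ⟨?_, ha⟩
        lift a to ℝ≥0 using ha
        lift b to ℝ≥0 using hb
        have h' : ((a : ℝ) : EReal) - ((b : ℝ) : EReal) = 0 := h
        norm_cast at h'
        have : (a : ℝ) = b := by exact_mod_cast sub_eq_zero.1 h'
        exact_mod_cast this
  · rintro ⟨rfl, ha⟩
    exact EReal.sub_self (by simpa using ha) (by simp)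

/-- Under no-arbitrage, every model is dominated by a martingale measure which is in turn
dominated by a model. -/
theorem NA1.exists_martingale_measure {C : Set (ProbabilityMeasure Ω)} (hC : ConvexPM C)
    {X : Ω → Fin d → ℝ} (hX : Measurable X)
    (hNA : NA1 ((fun P : ProbabilityMeasure Ω => (P : Measure Ω)) '' C) X)
    {P : ProbabilityMeasure Ω} (hP : P ∈ C) :
    ∃ Q P' : ProbabilityMeasure Ω, P' ∈ C ∧ (P : Measure Ω) ≪ (Q : Measure Ω) ∧
      (Q : Measure Ω) ≪ (P' : Measure Ω) ∧ ∀ i, expec (Q : Measure Ω) (fun ω => X ω i) = 0 := by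
  let N : Submodule ℝ (Fin d → ℝ) :=
    { carrier := {y | ∀ R ∈ C, ∀ᵐ ω ∂(R : Measure Ω), y ⬝ᵥ X ω = 0}
      zero_mem' := fun R _ => Eventually.of_forall fun ω => zero_dotProduct _
      add_mem' := fun {a b} ha hb R hR => by
        filter_upwards [ha R hR, hb R hR] with ω h1 h2
        rw [add_dotProduct, h1, h2, add_zero]
      smul_mem' := fun c y hy R hR => by
        filter_upwards [hy R hR] with ω h
        rw [smul_dotProduct, h, smul_zero] }
  obtain ⟨V, hNV⟩ := N.exists_isCompl
  have hloss : ∀ v ∈ V, v ≠ 0 → ∃ R ∈ C, 0 < (R : Measure Ω) {ω | v ⬝ᵥ X ω < 0} := by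
    intro v hv hne
    by_contra! hcon
    refine hne (Submodule.disjoint_def.1 hNV.disjoint v ?_ hv)
    have hm := measurable_dotProduct_const hX v
    refine (quasiSure_coe_image_iff (hm (measurableSet_singleton 0))).1 (hNA v ?_)
    refine (quasiSure_coe_image_iff (hm measurableSet_Ici)).2 fun R hR => ?_
    have h0 : (R : Measure Ω) {ω | v ⬝ᵥ X ω < 0} = 0 := nonpos_iff_eq_zero.1 (hcon R hR)
    refine measure_mono_null (fun ω hω => ?_) h0
    exact not_le.1 fun h : 0 ≤ v ⬝ᵥ X ω => hω h
  let K : Set (Fin d → ℝ) := Metric.sphere 0 1 ∩ V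
  have hK : IsCompact K := (isCompact_sphere _ _).inter_right V.closed_of_finiteDimensional
  have hKne : ∀ v ∈ K, v ≠ 0 := by
    rintro v ⟨hv, -⟩ rfl
    simp at hv
  have : Nonempty (ProbabilityMeasure Ω) := ⟨P⟩
  choose! R hRC hRpos using hloss
  obtain ⟨s, hs⟩ := hK.elim_finite_subcover
    (fun v : K => {z : Fin d → ℝ | 0 < (R v : Measure Ω) {ω | z ⬝ᵥ X ω < 0}})
    (fun v => isOpen_measure_dotProduct_neg_pos _ hX)
    (fun v hv => mem_iUnion.2 ⟨⟨v, hv⟩, hRpos v hv.2 (hKne v hv)⟩)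
  obtain ⟨P', hP', hPP', hRP'⟩ := hC.exists_dominating hP s (fun v : K => R v)
    fun v _ => hRC v v.2.2 (hKne v v.2)
  have hV : ∀ v ∈ V, v ≠ 0 → 0 < (P' : Measure Ω) {ω | v ⬝ᵥ X ω < 0} := by
    intro v hv hne
    have hnv : 0 < ‖v‖ := norm_pos_iff.2 hne
    have hmem : ‖v‖⁻¹ • v ∈ K :=
      ⟨mem_sphere_zero_iff_norm.2 (by rw [norm_smul, norm_inv, norm_norm, inv_mul_cancel₀ hnv.ne']),
        V.smul_mem _ hv⟩
    obtain ⟨w, hw, hwpos⟩ := mem_iUnion₂.1 (hs hmem)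
    rw [mem_ofPred_eq] at hwpos
    refine pos_iff_ne_zero.2 fun h => hwpos.ne' ?_
    refine measure_mono_null (fun ω hω => ?_) (hRP' w hw h)
    rw [mem_ofPred_eq, smul_dotProduct, smul_eq_mul] at hω
    exact not_le.1 fun h => hω.not_ge (mul_nonneg (inv_nonneg.2 hnv.le) h)
  obtain ⟨Q, hP'Q, hQP', hXint, hQV⟩ := exists_equivalent_martingale_measure (P' : Measure Ω) hX V hV
  refine ⟨Q, P', hP', hPP'.trans hP'Q, hQP', fun i => ?_⟩
  refine expec_eq_zero_of_integral_eq_zero (hXint.eval i) ?_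
  obtain ⟨n, v, hn, hv, hnv⟩ := Submodule.codisjoint_iff_exists_add_eq.1 hNV.codisjoint
    (Pi.single i (1 : ℝ))
  rw [← hQV v hv]
  refine integral_congr_ae ?_
  filter_upwards [hQP'.ae_le (hn P' hP')] with ω hω
  rw [← single_one_dotProduct i (X ω), ← hnv, add_dotProduct, hω, zero_add]

end DominatingMeasure

end BN

namespace BN

section Graph

variable {α Y : Type*} [MeasurableSpace α] [TopologicalSpace Y] [PolishSpace Y]
  [MeasurableSpace Y] [BorelSpace Y]

/-- A Borel family of probability measures, as a kernel. -/
def kernelOfMeasurable (κ : α → ProbabilityMeasure Y)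
    (hκ : Measurable[_, borel (ProbabilityMeasure Y)] κ) : ProbabilityTheory.Kernel α Y where
  toFun a := κ a
  measurable' := measurable_toMeasure_borel.comp hκ

instance (κ : α → ProbabilityMeasure Y) (hκ : Measurable[_, borel (ProbabilityMeasure Y)] κ) :
    ProbabilityTheory.IsMarkovKernel (kernelOfMeasurable κ hκ) :=
  ⟨fun a => (κ a).2⟩

theorem measurableSet_absolutelyContinuous {κ η : α → ProbabilityMeasure Y}
    (hκ : Measurable[_, borel (ProbabilityMeasure Y)] κ)
    (hη : Measurable[_, borel (ProbabilityMeasure Y)] η) :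
    MeasurableSet {a | (κ a : Measure Y) ≪ (η a : Measure Y)} :=
  ProbabilityTheory.Kernel.measurableSet_absolutelyContinuous
    (kernelOfMeasurable κ hκ) (kernelOfMeasurable η hη)

theorem measurableSet_expec_eq_zero {κ : α → ProbabilityMeasure Y}
    (hκ : Measurable[_, borel (ProbabilityMeasure Y)] κ) {f : α → Y → ℝ}
    (hf : Measurable (Function.uncurry f)) :
    MeasurableSet {a | expec (κ a : Measure Y) (f a) = 0} := by
  simp only [expec_eq_zero_iff]
  have h1 : Measurable fun a => ∫⁻ y, ENNReal.ofReal (f a y) ∂(κ a : Measure Y) :=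
    Measurable.lintegral_kernel_prod_right (κ := kernelOfMeasurable κ hκ)
      (f := fun a y => ENNReal.ofReal (f a y)) hf.ennreal_ofReal
  have h2 : Measurable fun a => ∫⁻ y, ENNReal.ofReal (-f a y) ∂(κ a : Measure Y) :=
    Measurable.lintegral_kernel_prod_right (κ := kernelOfMeasurable κ hκ)
      (f := fun a y => ENNReal.ofReal (-f a y)) hf.neg.ennreal_ofReal
  exact (measurableSet_eq_fun h1 h2).inter (h1 (measurableSet_singleton ⊤)).compl

theorem AnalyticSet.inter {β : Type*} [TopologicalSpace β] [T2Space β] {s t : Set β}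
    (hs : AnalyticSet s) (ht : AnalyticSet t) : AnalyticSet (s ∩ t) := by
  rw [inter_eq_iInter]
  exact AnalyticSet.iInter fun b => by cases b <;> assumption

theorem exists_continuous_surjective_probabilityMeasure (Y : Type*) [TopologicalSpace Y]
    [PolishSpace Y] [MeasurableSpace Y] [BorelSpace Y] [Nonempty Y] :
    ∃ g : (ℕ → ℕ) → ProbabilityMeasure Y, Continuous g ∧ Function.Surjective g := by
  have h := analyticSet_univ_probabilityMeasure Y
  rw [AnalyticSet] at h
  rcases h with h | ⟨g, hg, hrange⟩
  · have y := Classical.arbitrary Y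
    exact absurd (mem_univ (⟨Measure.dirac y, inferInstance⟩ : ProbabilityMeasure Y)) (h ▸ notMem_empty _)
  · exact ⟨g, hg, range_eq_univ.1 hrange⟩

variable {X : Type*} [TopologicalSpace X] [PolishSpace X] [MeasurableSpace X] [BorelSpace X]
  {d : ℕ}

/-- The set of parameters of pairs `(Q, P)` with `P` in the model at `ω` and `Q` a martingale
measure dominated by `P`. -/
theorem analyticSet_martingale_pair {C : X → Set (ProbabilityMeasure Y)}
    (hC : AnalyticSet {p : X × ProbabilityMeasure Y | p.2 ∈ C p.1}) {F : X → Y → Fin d → ℝ}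
    (hF : Measurable (Function.uncurry F)) {g : (ℕ → ℕ) → ProbabilityMeasure Y}
    (hg : Continuous g) :
    AnalyticSet {p : X × (ℕ → ℕ) × (ℕ → ℕ) | g p.2.2 ∈ C p.1 ∧
      (g p.2.1 : Measure Y) ≪ (g p.2.2 : Measure Y) ∧
        ∀ i, expec (g p.2.1 : Measure Y) (fun y => F p.1 y i) = 0} := by
  have h1 : Measurable[_, borel (ProbabilityMeasure Y)]
      fun p : X × (ℕ → ℕ) × (ℕ → ℕ) => g p.2.1 := by
    borelize (ProbabilityMeasure Y)
    exact hg.measurable.comp (measurable_fst.comp measurable_snd)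
  have h2 : Measurable[_, borel (ProbabilityMeasure Y)]
      fun p : X × (ℕ → ℕ) × (ℕ → ℕ) => g p.2.2 := by
    borelize (ProbabilityMeasure Y)
    exact hg.measurable.comp (measurable_snd.comp measurable_snd)
  have h3 : MeasurableSet {p : X × (ℕ → ℕ) × (ℕ → ℕ) |
      ∀ i, expec (g p.2.1 : Measure Y) (fun y => F p.1 y i) = 0} := by
    have : {p : X × (ℕ → ℕ) × (ℕ → ℕ) | ∀ i, expec (g p.2.1 : Measure Y) (fun y => F p.1 y i) = 0}
        = ⋂ i, {p : X × (ℕ → ℕ) × (ℕ → ℕ) |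
          expec (g p.2.1 : Measure Y) (fun y => F p.1 y i) = 0} := by
      ext p
      simp
    rw [this]
    refine MeasurableSet.iInter fun i => measurableSet_expec_eq_zero h1
      (f := fun p y => F p.1 y i) ?_
    exact (measurable_pi_apply i).comp
      (hF.comp ((measurable_fst.comp measurable_fst).prodMk measurable_snd))
  exact AnalyticSet.inter
    (hC.preimage (f := fun p : X × (ℕ → ℕ) × (ℕ → ℕ) => (p.1, g p.2.2)) (by fun_prop))
    ((measurableSet_absolutelyContinuous h1 h2).inter h3).analyticSet

theorem analyticSet_graph_martingale_measures [Nonempty Y] {C : X → Set (ProbabilityMeasure Y)}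
    (hC : AnalyticSet {p : X × ProbabilityMeasure Y | p.2 ∈ C p.1}) {F : X → Y → Fin d → ℝ}
    (hF : Measurable (Function.uncurry F)) :
    AnalyticSet {p : X × ProbabilityMeasure Y | (∃ P ∈ C p.1, (p.2 : Measure Y) ≪ (P : Measure Y)) ∧
      ∀ i, expec (p.2 : Measure Y) (fun y => F p.1 y i) = 0} := by
  obtain ⟨g, hg, hsurj⟩ := exists_continuous_surjective_probabilityMeasure Y
  convert (analyticSet_martingale_pair hC hF hg).image_of_continuous
    (f := fun p : X × (ℕ → ℕ) × (ℕ → ℕ) => (p.1, g p.2.1)) (by fun_prop) using 1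
  ext ⟨ω, Q⟩
  constructor
  · rintro ⟨⟨P, hP, hQP⟩, hE⟩
    obtain ⟨z, rfl⟩ := hsurj Q
    obtain ⟨z', rfl⟩ := hsurj P
    exact ⟨(ω, z, z'), ⟨hP, hQP, hE⟩, rfl⟩
  · rintro ⟨⟨ω', z, z'⟩, ⟨hP, hQP, hE⟩, h⟩
    obtain ⟨rfl, rfl⟩ := Prod.mk.inj h
    exact ⟨⟨_, hP, hQP⟩, hE⟩

theorem exists_measurable_martingale_selection [Nonempty Y] {C : X → Set (ProbabilityMeasure Y)}
    (hC : AnalyticSet {p : X × ProbabilityMeasure Y | p.2 ∈ C p.1})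
    (hconv : ∀ ω, ConvexPM (C ω)) {F : X → Y → Fin d → ℝ}
    (hF : Measurable (Function.uncurry F)) {P : X → ProbabilityMeasure Y}
    (hP : Measurable[_, borel (ProbabilityMeasure Y)] P) :
    ∃ Q P' : X → ProbabilityMeasure Y,
      Measurable[univComp X, borel (ProbabilityMeasure Y)] Q ∧
      Measurable[univComp X, borel (ProbabilityMeasure Y)] P' ∧
      (∀ ω, (P ω : Measure Y) ≪ (Q ω : Measure Y) ∧ (Q ω : Measure Y) ≪ (P' ω : Measure Y)) ∧
      (∀ ω, P ω ∈ C ω → P' ω ∈ C ω) ∧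
      ∀ ω, NA1 ((fun R : ProbabilityMeasure Y => (R : Measure Y)) '' C ω) (F ω) → P ω ∈ C ω →
        ∀ i, expec (Q ω : Measure Y) (fun y => F ω y i) = 0 := by
  classical
  obtain ⟨g, hg, hsurj⟩ := exists_continuous_surjective_probabilityMeasure Y
  have hdom : MeasurableSet
      {p : X × (ℕ → ℕ) × (ℕ → ℕ) | (P p.1 : Measure Y) ≪ (g p.2.1 : Measure Y)} := by
    refine measurableSet_absolutelyContinuous (κ := fun p : X × (ℕ → ℕ) × (ℕ → ℕ) => P p.1)
      (η := fun p => g p.2.1) ?_ ?_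
    all_goals borelize (ProbabilityMeasure Y)
    · exact hP.comp measurable_fst
    · exact hg.measurable.comp (measurable_fst.comp measurable_snd)
  have hD := AnalyticSet.inter (analyticSet_martingale_pair hC hF hg) hdom.analyticSet
  set D := {p : X × (ℕ → ℕ) × (ℕ → ℕ) | g p.2.2 ∈ C p.1 ∧
      (g p.2.1 : Measure Y) ≪ (g p.2.2 : Measure Y) ∧
        ∀ i, expec (g p.2.1 : Measure Y) (fun y => F p.1 y i) = 0} ∩
    {p : X × (ℕ → ℕ) × (ℕ → ℕ) | (P p.1 : Measure Y) ≪ (g p.2.1 : Measure Y)} with hDdef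
  obtain ⟨σ, hσ, hσD⟩ := exists_measurable_univComp_section hD
  have hB : MeasurableSet[univComp X] (Prod.fst '' D) :=
    measurableSet_univComp_of_analyticSet (hD.image_of_continuous continuous_fst)
  have hite : ∀ φ : (ℕ → ℕ) × (ℕ → ℕ) → ProbabilityMeasure Y, Continuous φ →
      Measurable[univComp X, borel (ProbabilityMeasure Y)]
        fun ω => if ω ∈ Prod.fst '' D then φ (σ ω) else P ω := by
    intro φ hφ
    refine @Measurable.ite _ _ _ _ (univComp X) (borel (ProbabilityMeasure Y)) _ _ hB ?_ ?_
    · exact hφ.borel_measurable.comp hσ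
    · exact fun s hs μ _ => (hP hs).nullMeasurableSet
  refine ⟨_, _, hite _ (hg.comp continuous_fst), hite _ (hg.comp continuous_snd), fun ω => ?_,
    fun ω hω => ?_, fun ω hNA hω i => ?_⟩
  · by_cases h : ω ∈ Prod.fst '' D
    · simp only [if_pos h]
      exact ⟨(hσD ω h).2, (hσD ω h).1.2.1⟩
    · simp only [if_neg h]
      exact ⟨Measure.AbsolutelyContinuous.rfl, Measure.AbsolutelyContinuous.rfl⟩
  · by_cases h : ω ∈ Prod.fst '' D
    · simp only [if_pos h]
      exact (hσD ω h).1.1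
    · simpa only [if_neg h] using hω
  · obtain ⟨Q, R, hR, hPQ, hQR, hE⟩ :=
      hNA.exists_martingale_measure (hconv ω) (hF.comp measurable_prodMk_left) hω
    obtain ⟨z, rfl⟩ := hsurj Q
    obtain ⟨z', rfl⟩ := hsurj R
    have h : ω ∈ Prod.fst '' D := ⟨(ω, z, z'), ⟨⟨hR, hQR, hE⟩, hPQ⟩, rfl⟩
    simp only [if_pos h]
    exact (hσD ω h).1.2.2 i

end Graph

theorem measurable_uncurry_incr {Ω₁ : Type} [MeasurableSpace Ω₁] {d : ℕ}
    {S : (t : ℕ) → (Fin t → Ω₁) → Fin d → ℝ} {t : ℕ} (h₀ : Measurable (S t))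
    (h₁ : Measurable (S (t + 1))) : Measurable (Function.uncurry (incr Ω₁ S t)) := by
  have hsnoc : Measurable fun p : (Fin t → Ω₁) × Ω₁ =>
      (Fin.snoc p.1 p.2 : Fin (t + 1) → Ω₁) := by
    refine measurable_pi_iff.2 fun i => ?_
    refine Fin.lastCases ?_ (fun j => ?_) i
    · simpa using measurable_snd
    · simpa using! (measurable_pi_apply j).comp measurable_fst
  refine measurable_pi_iff.2 fun i => ?_
  exact ((measurable_pi_apply i).comp (h₁.comp hsnoc)).sub
    ((measurable_pi_apply i).comp (h₀.comp measurable_fst))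

end BN

open BN in
/-- **Measurable selection of one-step martingale measures** (Lemma 4.8). The graph
of `ω ↦ 𝒬_t(ω)` is analytic, and given a Borel kernel `P(·)` there are universally
measurable kernels `Q(·), P̂(·)` with `P(ω) ≪ Q(ω) ≪ P̂(ω)` for all `ω`,
`P̂(ω) ∈ 𝒫_t(ω)` whenever `P(ω) ∈ 𝒫_t(ω)`, and `Q(ω) ∈ 𝒬_t(ω)` whenever
`NA(𝒫_t(ω))` holds and `P(ω) ∈ 𝒫_t(ω)`. -/
theorem one_step_martingale_selection
    (Ω₁ : Type) [MeasurableSpace Ω₁] [TopologicalSpace Ω₁] [PolishSpace Ω₁]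
    [BorelSpace Ω₁] [Nonempty Ω₁] (T d : ℕ)
    (Pt : (t : ℕ) → (Fin t → Ω₁) → Set (ProbabilityMeasure Ω₁))
    (hPtne : ∀ t, t < T → ∀ ω, (Pt t ω).Nonempty)
    (hPtconv : ∀ t, t < T → ∀ ω, ConvexPM (Pt t ω))
    (hPtgraph : ∀ t, t < T →
      AnalyticSet {p : (Fin t → Ω₁) × ProbabilityMeasure Ω₁ | p.2 ∈ Pt t p.1})
    (S : (t : ℕ) → (Fin t → Ω₁) → Fin d → ℝ) (hS : ∀ t, t ≤ T → Measurable (S t))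
    (t : ℕ) (ht : t < T)
    (Pmap : (Fin t → Ω₁) → ProbabilityMeasure Ω₁)
    (hPmap : @Measurable _ _ _ (borel (ProbabilityMeasure Ω₁)) Pmap) :
    AnalyticSet {p : (Fin t → Ω₁) × ProbabilityMeasure Ω₁ | p.2 ∈ Q1fam Ω₁ Pt S t p.1} ∧
    ∃ Qmap Phat : (Fin t → Ω₁) → ProbabilityMeasure Ω₁,
      @Measurable _ _ (univComp (Fin t → Ω₁)) (borel (ProbabilityMeasure Ω₁)) Qmap ∧
      @Measurable _ _ (univComp (Fin t → Ω₁)) (borel (ProbabilityMeasure Ω₁)) Phat ∧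
      (∀ ω, (Pmap ω : Measure Ω₁) ≪ (Qmap ω : Measure Ω₁) ∧
        (Qmap ω : Measure Ω₁) ≪ (Phat ω : Measure Ω₁)) ∧
      (∀ ω, Pmap ω ∈ Pt t ω → Phat ω ∈ Pt t ω) ∧
      (∀ ω, NA1 ((fun P : ProbabilityMeasure Ω₁ => (P : Measure Ω₁)) '' Pt t ω)
          (incr Ω₁ S t ω) → Pmap ω ∈ Pt t ω → Qmap ω ∈ Q1fam Ω₁ Pt S t ω) := by
  have hF := measurable_uncurry_incr (hS t ht.le) (hS (t + 1) ht)
  refine ⟨analyticSet_graph_martingale_measures (hPtgraph t ht) hF, ?_⟩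
  obtain ⟨Q, P', hQ, hP', hdom, hmem, hE⟩ :=
    exists_measurable_martingale_selection (hPtgraph t ht) (hPtconv t ht) hF hPmap
  exact ⟨Q, P', hQ, hP', hdom, hmem, fun ω hNA hω =>
    ⟨⟨P' ω, hmem ω hω, (hdom ω).2⟩, hE ω hNA hω⟩⟩
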